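/- Fix y = (y₁,y₂,y₃) ∈ ℝ³ with y₃ > 0 and f ∈ ℝ³. Define uᵂᵢ(x) = Σⱼ Sᵢⱼ(x,y) fⱼ − Σⱼ Sᵢⱼ(x,yᴵ) fᴵⱼ − [x₃ ∂φ/∂xᵢ(x) − δᵢ₃ φ(x)], where φ(x) = fᴵ₃ Gˢ(x,yᴵ) + y₃ Gᴰ[fᴵ](x,yᴵ). Then uᵂ decays at infinity in the closed upper half-space: for every ε > 0 there exists R > 0 such that |uᵂ(x)| < ε for all x with x₃ ≥ 0 and |x| > R. -/

import Mathlib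

open Real Finset

noncomputable section

/-- Points in three-dimensional Euclidean space. -/
abbrev E3 := EuclideanSpace ℝ (Fin 3)

/-- Partial derivative `∂f/∂xᵢ` of a scalar field on `ℝ³`. -/
def pd (i : Fin 3) (f : E3 → ℝ) (x : E3) : ℝ :=
  fderiv ℝ f x (EuclideanSpace.single i 1)

/-- Kronecker delta. -/
def kron (i j : Fin 3) : ℝ := if i = j then 1 else 0

/-- Reflected image point `yᴵ = (y₁, y₂, -y₃)`. -/
def reflPt (y : E3) : E3 := (EuclideanSpace.equiv (Fin 3) ℝ).symm ![y 0, y 1, -y 2]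

/-- Reflected vector `fᴵ = (f₁, f₂, -f₃)`. -/
def reflVec (f : Fin 3 → ℝ) : Fin 3 → ℝ := ![f 0, f 1, -f 2]

/-- Harmonic potential of a unit charge, `Gˢ(x,y) = 1/(4π|x-y|)`. -/
def GS (x y : E3) : ℝ := 1 / (4 * π * ‖x - y‖)

/-- Harmonic potential of a unit dipole with orientation `ν`:
`Gᴰ[ν](x,y) = Σᵢ νᵢ ∂/∂yᵢ Gˢ(x,y)`. -/
def GD (ν : Fin 3 → ℝ) (x y : E3) : ℝ := ∑ i, ν i * pd i (fun z => GS x z) y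

/-- Harmonic potential of a unit quadrupole with orientations `ν, κ`:
`G^Q[ν,κ](x,y) = Σᵢ Σⱼ νᵢ κⱼ ∂²/∂yᵢ∂yⱼ Gˢ(x,y)`. -/
def GQ (ν κ : Fin 3 → ℝ) (x y : E3) : ℝ :=
  ∑ i, ∑ j, ν i * κ j * pd i (fun z => pd j (fun w => GS x w) z) y

/-- The Stokeslet (single layer kernel)
`Sᵢⱼ(x,y) = (1/8π)[δᵢⱼ/|x-y| + (xᵢ-yᵢ)(xⱼ-yⱼ)/|x-y|³]`. -/
def stokeslet (x y : E3) (i j : Fin 3) : ℝ :=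
  (1 / (8 * π)) * (kron i j / ‖x - y‖ + (x i - y i) * (x j - y j) / ‖x - y‖ ^ 3)

/-- The Papkovich–Neuber potential for the Stokeslet image system:
`φ(x) = fᴵ₃ Gˢ(x,yᴵ) + y₃ Gᴰ[fᴵ](x,yᴵ)`. -/
def phiS (y : E3) (f : Fin 3 → ℝ) (x : E3) : ℝ :=
  reflVec f 2 * GS x (reflPt y) + y 2 * GD (reflVec f) x (reflPt y)

/-- The half-space Stokeslet velocity
`uᵂᵢ(x) = Σⱼ Sᵢⱼ(x,y) fⱼ - Σⱼ Sᵢⱼ(x,yᴵ) fᴵⱼ - [x₃ ∂φ/∂xᵢ(x) - δᵢ₃ φ(x)]`. -/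
def uW (y : E3) (f : Fin 3 → ℝ) (i : Fin 3) (x : E3) : ℝ :=
  (∑ j, stokeslet x y i j * f j) - (∑ j, stokeslet x (reflPt y) i j * reflVec f j)
    - (x 2 * pd i (phiS y f) x - if i = 2 then phiS y f x else 0)

open Filter Asymptotics Bornology Topology

theorem hasFDerivAt_norm_sub {E : Type*} [NormedAddCommGroup E] [InnerProductSpace ℝ E]
    {x c : E} (h : x ≠ c) :
    HasFDerivAt (fun z => ‖z - c‖) (‖x - c‖⁻¹ • innerSL ℝ (x - c)) x := by
  have hN : ‖x - c‖ ≠ 0 := norm_ne_zero_iff.mpr (sub_ne_zero.mpr h)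
  have h1 := (((hasFDerivAt_id x).sub_const c).norm_sq).sqrt (by simpa using hN)
  simp only [id, Real.sqrt_sq (norm_nonneg _)] at h1
  convert h1 using 1
  ext v
  simp
  field_simp

theorem hasFDerivAt_inv_norm_sub_pow {E : Type*} [NormedAddCommGroup E] [InnerProductSpace ℝ E]
    {x c : E} (h : x ≠ c) (n : ℕ) :
    HasFDerivAt (fun z => (‖z - c‖ ^ n)⁻¹)
      ((-(n * (‖x - c‖ ^ (n + 2))⁻¹)) • innerSL ℝ (x - c)) x := by
  have hN : ‖x - c‖ ≠ 0 := norm_ne_zero_iff.mpr (sub_ne_zero.mpr h)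
  have h1 := ((hasDerivAt_pow n ‖x - c‖).fun_inv (pow_ne_zero n hN)).comp_hasFDerivAt x
    (hasFDerivAt_norm_sub h)
  refine h1.congr_fderiv ?_
  rw [smul_smul]
  congr 1
  rcases n with _ | n
  · simp
  · simp only [Nat.add_sub_cancel]
    field_simp
    ring

theorem pd_GS {x c : E3} (h : x ≠ c) (i : Fin 3) :
    pd i (fun z => GS x z) c = (4 * π)⁻¹ * ((x i - c i) * (‖x - c‖ ^ 3)⁻¹) := by
  have h1 : (fun z => GS x z) = fun z => (4 * π)⁻¹ * (‖z - x‖ ^ 1)⁻¹ := by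
    ext z
    rw [GS, norm_sub_rev, pow_one, one_div, mul_inv]
  rw [pd, h1, ((hasFDerivAt_inv_norm_sub_pow h.symm 1).const_mul _).fderiv, norm_sub_rev c x]
  simp [EuclideanSpace.inner_single_right]
  ring

theorem GD_eq {x c : E3} (h : x ≠ c) (ν : Fin 3 → ℝ) :
    GD ν x c = ∑ j, (4 * π)⁻¹ * ν j * ((x j - c j) * (‖x - c‖ ^ 3)⁻¹) :=
  Finset.sum_congr rfl fun j _ => by rw [pd_GS h]; ring

theorem phiS_eq {y x : E3} (h : x ≠ reflPt y) (f : Fin 3 → ℝ) :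
    phiS y f x = (4 * π)⁻¹ * reflVec f 2 * (‖x - reflPt y‖ ^ 1)⁻¹ +
      ∑ j, (4 * π)⁻¹ * y 2 * reflVec f j *
        ((x j - reflPt y j) * (‖x - reflPt y‖ ^ 3)⁻¹) := by
  rw [phiS, GD_eq h, GS, one_div, mul_inv, pow_one, Finset.mul_sum]
  congr 1
  · ring
  · exact Finset.sum_congr rfl fun j _ => by ring

theorem pd_phiS {y x : E3} (h : x ≠ reflPt y) (f : Fin 3 → ℝ) (i : Fin 3) :
    pd i (phiS y f) x =
      (4 * π)⁻¹ * reflVec f 2 * -((x i - reflPt y i) * (‖x - reflPt y‖ ^ 3)⁻¹) +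
      ∑ j, (4 * π)⁻¹ * y 2 * reflVec f j *
        (kron j i * (‖x - reflPt y‖ ^ 3)⁻¹ - 3 * ((x j - reflPt y j) * (x i - reflPt y i) *
          (‖x - reflPt y‖ ^ 5)⁻¹)) := by
  have hev : phiS y f =ᶠ[𝓝 x] _ :=
    (eventually_ne_nhds h).mono fun z hz => phiS_eq hz f
  have hcoord (j : Fin 3) : HasFDerivAt (fun z : E3 => z j - reflPt y j)
      (EuclideanSpace.proj j : E3 →L[ℝ] ℝ) x :=
    ((EuclideanSpace.proj j : E3 →L[ℝ] ℝ).hasFDerivAt).sub_const _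
  have hd := ((hasFDerivAt_inv_norm_sub_pow h 1).const_mul ((4 * π)⁻¹ * reflVec f 2)).fun_add
    (HasFDerivAt.fun_sum (u := Finset.univ) fun j _ =>
      ((hcoord j).fun_mul (hasFDerivAt_inv_norm_sub_pow h 3)).const_mul
        ((4 * π)⁻¹ * y 2 * reflVec f j))
  rw [pd, hev.fderiv_eq, hd.fderiv]
  simp only [_root_.add_apply, _root_.sum_apply, _root_.smul_apply, innerSL_apply_apply,
    EuclideanSpace.inner_single_right, smul_eq_mul, PiLp.sub_apply, PiLp.proj_apply,
    PiLp.single_apply, kron, conj_trivial, Nat.cast_one, Nat.cast_ofNat]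
  congr 1
  · ring
  · exact Finset.sum_congr rfl fun j _ => by ring

theorem isBigO_coord_sub (c : E3) (i : Fin 3) (l : Filter E3) :
    (fun x : E3 => x i - c i) =O[l] fun x => ‖x - c‖ :=
  .of_bound 1 (.of_forall fun x => by simpa using PiLp.norm_apply_le (x - c) i)

theorem tendsto_norm_sub_cobounded {E : Type*} [NormedAddCommGroup E] (c : E) :
    Tendsto (fun x => ‖x - c‖) (cobounded E) atTop :=
  tendsto_atTop_mono (fun x => norm_sub_norm_le x c)
    (tendsto_atTop_add_const_right _ (-‖c‖) tendsto_norm_cobounded_atTop)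

theorem isBigO_coord (c : E3) (i : Fin 3) :
    (fun x : E3 => x i) =O[cobounded E3] fun x => ‖x - c‖ := by
  have h : (fun _ : E3 => c i) =O[cobounded E3] fun x => ‖x - c‖ :=
    (isLittleO_const_left.mpr (.inr (by
      simpa only [Function.comp_def, norm_norm] using tendsto_norm_sub_cobounded c))).isBigO
  simpa using (isBigO_coord_sub c i _).add h

theorem tendsto_mul_inv_norm_sub_pow {E : Type*} [NormedAddCommGroup E] {c : E} {g : E → ℝ}
    {k n : ℕ} (hg : g =O[cobounded E] fun x => ‖x - c‖ ^ k) (hkn : k < n) :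
    Tendsto (fun x => g x * (‖x - c‖ ^ n)⁻¹) (cobounded E) (𝓝 0) :=
  (hg.mul (isBigO_refl (fun x => (‖x - c‖ ^ n)⁻¹) _)).trans_tendsto
    ((tendsto_pow_div_pow_atTop_zero hkn).comp (tendsto_norm_sub_cobounded c))

theorem isBigO_coord_sub_mul (c : E3) (i j : Fin 3) (l : Filter E3) :
    (fun x : E3 => (x i - c i) * (x j - c j)) =O[l] fun x => ‖x - c‖ ^ 2 := by
  simpa only [sq] using (isBigO_coord_sub c i l).mul (isBigO_coord_sub c j l)

theorem isBigO_const_one_norm_sub {E : Type*} [NormedAddCommGroup E] (a : ℝ) (c : E)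
    (l : Filter E) : (fun _ : E => a) =O[l] fun x => ‖x - c‖ ^ 0 := by
  simpa only [pow_zero] using isBigO_const_const a one_ne_zero l

theorem tendsto_stokeslet (c : E3) (i j : Fin 3) :
    Tendsto (fun x => stokeslet x c i j) (cobounded E3) (𝓝 0) := by
  have h := ((tendsto_mul_inv_norm_sub_pow (isBigO_const_one_norm_sub (kron i j) c _)
    one_pos).add (tendsto_mul_inv_norm_sub_pow (isBigO_coord_sub_mul c i j _)
      (show 2 < 3 by norm_num))).const_mul (1 / (8 * π))
  simpa only [stokeslet, div_eq_mul_inv, pow_one, add_zero, mul_zero] using h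

theorem tendsto_phiS (y : E3) (f : Fin 3 → ℝ) :
    Tendsto (phiS y f) (cobounded E3) (𝓝 0) := by
  have h := (tendsto_mul_inv_norm_sub_pow (isBigO_const_one_norm_sub
    ((4 * π)⁻¹ * reflVec f 2) (reflPt y) _) one_pos).add
    (tendsto_finsetSum Finset.univ fun j _ => (tendsto_mul_inv_norm_sub_pow (k := 1) (n := 3)
      (by simpa only [pow_one] using isBigO_coord_sub (reflPt y) j _) (by norm_num)).const_mul
        ((4 * π)⁻¹ * y 2 * reflVec f j))
  simp only [mul_zero, Finset.sum_const_zero, add_zero] at h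
  exact h.congr' ((eventually_ne_cobounded (reflPt y)).mono fun x hx => (phiS_eq hx f).symm)

theorem tendsto_coord_mul_pd_phiS (y : E3) (f : Fin 3 → ℝ) (k i : Fin 3) :
    Tendsto (fun x => x k * pd i (phiS y f) x) (cobounded E3) (𝓝 0) := by
  set c := reflPt y
  have h₁ : Tendsto (fun x : E3 => x k * (x i - c i) * (‖x - c‖ ^ 3)⁻¹) (cobounded E3) (𝓝 0) :=
    tendsto_mul_inv_norm_sub_pow (k := 2)
      (by simpa only [sq] using (isBigO_coord c k).mul (isBigO_coord_sub c i _)) (by norm_num)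
  have h₂ : Tendsto (fun x : E3 => x k * (‖x - c‖ ^ 3)⁻¹) (cobounded E3) (𝓝 0) :=
    tendsto_mul_inv_norm_sub_pow (k := 1)
      (by simpa only [pow_one] using isBigO_coord c k) (by norm_num)
  have h₃ (j : Fin 3) : Tendsto (fun x : E3 => x k * ((x j - c j) * (x i - c i)) *
      (‖x - c‖ ^ 5)⁻¹) (cobounded E3) (𝓝 0) :=
    tendsto_mul_inv_norm_sub_pow (k := 3)
      (by simpa only [← pow_succ'] using (isBigO_coord c k).mul (isBigO_coord_sub_mul c j i _))
      (by norm_num)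
  have h := (h₁.const_mul (-((4 * π)⁻¹ * reflVec f 2))).add
    (tendsto_finsetSum Finset.univ fun j _ =>
      ((h₂.const_mul (kron j i)).sub ((h₃ j).const_mul 3)).const_mul
        ((4 * π)⁻¹ * y 2 * reflVec f j))
  simp only [mul_zero, sub_zero, Finset.sum_const_zero, add_zero] at h
  refine h.congr' ((eventually_ne_cobounded c).mono fun x hx => ?_)
  beta_reduce
  rw [pd_phiS hx, mul_add, Finset.mul_sum]
  congr 1
  · ring
  · exact Finset.sum_congr rfl fun j _ => by ring

theorem tendsto_uW (y : E3) (f : Fin 3 → ℝ) (i : Fin 3) :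
    Tendsto (uW y f i) (cobounded E3) (𝓝 0) := by
  have hS (c : E3) (g : Fin 3 → ℝ) :
      Tendsto (fun x => ∑ j, stokeslet x c i j * g j) (cobounded E3) (𝓝 0) := by
    simpa using tendsto_finsetSum Finset.univ fun j _ => (tendsto_stokeslet c i j).mul_const (g j)
  have hphi : Tendsto (fun x => if i = 2 then phiS y f x else 0) (cobounded E3) (𝓝 0) := by
    split_ifs
    · exact tendsto_phiS y f
    · exact tendsto_const_nhds
  have h := ((hS y f).sub (hS (reflPt y) (reflVec f))).sub
    ((tendsto_coord_mul_pd_phiS y f 2 i).sub hphi)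
  simp only [sub_zero] at h
  exact h

/-- the half-space Stokeslet velocity decays at infinity in the
closed upper half-space. -/
theorem stokeslet_halfspace_decay (y : E3) (hy : 0 < y 2) (f : Fin 3 → ℝ) :
    ∀ ε > 0, ∃ R > 0, ∀ x : E3, 0 ≤ x 2 → R < ‖x‖ →
      ‖(EuclideanSpace.equiv (Fin 3) ℝ).symm (fun i => uW y f i x)‖ < ε := by
  intro ε hε
  have hu : Tendsto (fun x => (EuclideanSpace.equiv (Fin 3) ℝ).symm (fun i => uW y f i x))
      (cobounded E3) (𝓝 0) := by
    have h := ((EuclideanSpace.equiv (Fin 3) ℝ).symm.continuous.tendsto 0).comp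
      (tendsto_pi_nhds.mpr fun i => tendsto_uW y f i)
    rwa [map_zero] at h
  have hev := (tendsto_zero_iff_norm_tendsto_zero.mp hu).eventually_lt_const hε
  rw [← comap_norm_atTop, eventually_comap] at hev
  obtain ⟨R, hR⟩ := eventually_atTop.mp hev
  exact ⟨max R 1, by positivity, fun x _ hx => hR ‖x‖ ((le_max_left R 1).trans hx.le) x rfl⟩
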